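/- Under the hypotheses of the previous invertibility result, i.e. G_T n_T×n_T symmetric with nonnegative entries, G_S n_S×n_S symmetric with nonnegative entries, G_TS an n_T×n_S matrix with entries in {0,1} having at most one nonzero entry in each row and column, G_ST = G_TSᵀ, λ_T ≥ 0, λ_S ≥ 0, β ∈ (−1,1) with max(λ_T·‖G_T‖, λ_S·‖G_S‖) < 1 − |β|, set A = fromBlocks(λ_T G_T, −β G_TS, −β G_ST, λ_S G_S) and let α = (α^T, α^S) ∈ ℝ^{n_T+n_S} be arbitrary. Then the series Σ_{k=0}^{∞} A^k·α converges in ℝ^{n_T+n_S}, and its sum equals (I − A)⁻¹·α, the unique solution y* of the equilibrium system (I − A)·y = α. -/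

import Mathlib

open Matrix

/-- The ℓ² operator norm of a real matrix: the norm of the induced linear map
between Euclidean spaces. -/
noncomputable def l2OpNorm {m n : Type*} [Fintype m] [Fintype n] [DecidableEq n]
    (A : Matrix m n ℝ) : ℝ :=
  ‖LinearMap.toContinuousLinearMap (Matrix.toEuclideanLin A)‖

lemma kb_bound {m n : Type*} [Fintype m] [Fintype n] [DecidableEq n]
    (M : Matrix m n ℝ) (v : n → ℝ) :
    ∑ i, (M *ᵥ v) i ^ 2 ≤ l2OpNorm M ^ 2 * ∑ j, v j ^ 2 := by
  have h := (LinearMap.toContinuousLinearMap (Matrix.toEuclideanLin M)).le_opNorm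
    (WithLp.toLp 2 v)
  have h2 := pow_le_pow_left₀ (norm_nonneg _) h 2
  rw [mul_pow, EuclideanSpace.norm_sq_eq, EuclideanSpace.norm_sq_eq] at h2
  simpa [l2OpNorm, Matrix.toLpLin_apply] using h2

open scoped Matrix.Norms.L2Operator in
lemma kb_norm_le {n : Type*} [Fintype n] [DecidableEq n]
    (M : Matrix n n ℝ) (c : ℝ) (hc : 0 ≤ c)
    (h : ∀ v : n → ℝ, ∑ i, (M *ᵥ v) i ^ 2 ≤ c ^ 2 * ∑ j, v j ^ 2) : ‖M‖ ≤ c := by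
  rw [Matrix.cstar_norm_def]
  refine ContinuousLinearMap.opNorm_le_bound _ hc fun x => ?_
  refine le_of_sq_le_sq ?_ (by positivity)
  rw [mul_pow, EuclideanSpace.norm_sq_eq, EuclideanSpace.norm_sq_eq]
  simpa using h x.ofLp

lemma kb_sum_le_one {n : Type*} [Fintype n] (f : n → ℝ) (h01 : ∀ j, f j = 0 ∨ f j = 1)
    (hs : {j | f j ≠ 0}.Subsingleton) : ∑ j, f j ≤ 1 := by
  by_cases h : ∃ j, f j ≠ 0
  · obtain ⟨j, hj⟩ := h
    rw [Finset.sum_eq_single j]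
    · rcases h01 j with h | h <;> simp [h]
    · intro b _ hb
      by_contra hne
      exact hb (hs hne hj)
    · simp
  · push Not at h
    simp [h]

lemma kb_partial {m n : Type*} [Fintype m] [Fintype n]
    (G : Matrix m n ℝ) (h01 : ∀ i j, G i j = 0 ∨ G i j = 1)
    (hrow : ∀ i, {j | G i j ≠ 0}.Subsingleton)
    (hcol : ∀ j, {i | G i j ≠ 0}.Subsingleton) (v : n → ℝ) :
    ∑ i, (G *ᵥ v) i ^ 2 ≤ ∑ j, v j ^ 2 := by
  have h1 : ∀ i, (G *ᵥ v) i ^ 2 ≤ ∑ j, G i j * v j ^ 2 := by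
    intro i
    have hcs := Finset.sum_mul_sq_le_sq_mul_sq Finset.univ (fun j => G i j)
      (fun j => G i j * v j)
    have e : ∀ j, G i j ^ 2 = G i j := fun j => by rcases h01 i j with h | h <;> simp [h]
    have e1 : ∀ j, G i j * (G i j * v j) = G i j * v j := fun j => by
      rw [← mul_assoc, ← sq, e]
    simp only [mul_pow, e, e1] at hcs
    have hs := kb_sum_le_one (G i) (h01 i) (hrow i)
    have hn : 0 ≤ ∑ j, G i j * v j ^ 2 := Finset.sum_nonneg fun j _ => by
      rcases h01 i j with h | h <;> simp [h, sq_nonneg]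
    calc (G *ᵥ v) i ^ 2 = (∑ j, G i j * v j) ^ 2 := rfl
      _ ≤ _ := hcs
      _ ≤ _ := mul_le_of_le_one_left hn hs
  calc _ ≤ ∑ i, ∑ j, G i j * v j ^ 2 := Finset.sum_le_sum fun i _ => h1 i
    _ = ∑ j, (∑ i, G i j) * v j ^ 2 := by
      rw [Finset.sum_comm]; simp only [Finset.sum_mul]
    _ ≤ _ := Finset.sum_le_sum fun j _ => mul_le_of_le_one_left (sq_nonneg _)
      (kb_sum_le_one (fun i => G i j) (fun i => h01 i j) (hcol j))

/-- Katz–Bonacich representation of the equilibrium: under Assumption 1, with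
`A = fromBlocks (λ_T G_T) (−β G_TS) (−β G_ST) (λ_S G_S)` and `α = (α^T, α^S)`,
the series `Σ_{k=0}^∞ A^k α` converges and its sum equals `(I − A)⁻¹ α`,
the unique solution of the equilibrium system `(I − A) y = α`. -/
theorem katz_bonacich_series
    (nT nS : ℕ)
    (GT : Matrix (Fin nT) (Fin nT) ℝ) (hGTsym : GT.IsSymm) (hGTpos : ∀ i j, 0 ≤ GT i j)
    (GS : Matrix (Fin nS) (Fin nS) ℝ) (hGSsym : GS.IsSymm) (hGSpos : ∀ i j, 0 ≤ GS i j)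
    (GTS : Matrix (Fin nT) (Fin nS) ℝ)
    (hGTS01 : ∀ i j, GTS i j = 0 ∨ GTS i j = 1)
    (hGTSrow : ∀ i, {j | GTS i j ≠ 0}.Subsingleton)
    (hGTScol : ∀ j, {i | GTS i j ≠ 0}.Subsingleton)
    (lamT lamS beta : ℝ) (hlamT : 0 ≤ lamT) (hlamS : 0 ≤ lamS) (hbeta : |beta| < 1)
    (hnet : max (lamT * l2OpNorm GT) (lamS * l2OpNorm GS) < 1 - |beta|)
    (alphaT : Fin nT → ℝ) (alphaS : Fin nS → ℝ)
    (A : Matrix (Fin nT ⊕ Fin nS) (Fin nT ⊕ Fin nS) ℝ)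
    (hA : A = fromBlocks (lamT • GT) ((-beta) • GTS) ((-beta) • GTSᵀ) (lamS • GS)) :
    HasSum (fun k : ℕ => (A ^ k) *ᵥ Sum.elim alphaT alphaS)
        ((1 - A)⁻¹ *ᵥ Sum.elim alphaT alphaS) ∧
    (∀ y : Fin nT ⊕ Fin nS → ℝ,
        (1 - A) *ᵥ y = Sum.elim alphaT alphaS ↔
          y = (1 - A)⁻¹ *ᵥ Sum.elim alphaT alphaS) := by
  letI : NormedRing (Matrix (Fin nT ⊕ Fin nS) (Fin nT ⊕ Fin nS) ℝ) :=
    Matrix.instL2OpNormedRing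
  have hT0 : 0 ≤ l2OpNorm GT := norm_nonneg _
  have hS0 : 0 ≤ l2OpNorm GS := norm_nonneg _
  have hc0 : 0 ≤ max (lamT * l2OpNorm GT) (lamS * l2OpNorm GS) :=
    le_max_of_le_left (mul_nonneg hlamT hT0)
  have hD : ‖fromBlocks (lamT • GT) 0 0 (lamS • GS)‖ ≤
      max (lamT * l2OpNorm GT) (lamS * l2OpNorm GS) := by
    refine kb_norm_le _ _ hc0 fun v => ?_
    have aT := kb_bound GT (v ∘ Sum.inl)
    have aS := kb_bound GS (v ∘ Sum.inr)
    have bT := pow_le_pow_left₀ (mul_nonneg hlamT hT0)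
      (le_max_left (lamT * l2OpNorm GT) (lamS * l2OpNorm GS)) 2
    have bS := pow_le_pow_left₀ (mul_nonneg hlamS hS0)
      (le_max_right (lamT * l2OpNorm GT) (lamS * l2OpNorm GS)) 2
    have sT : 0 ≤ ∑ j, (v ∘ Sum.inl) j ^ 2 := Finset.sum_nonneg fun _ _ => sq_nonneg _
    have sS : 0 ≤ ∑ j, (v ∘ Sum.inr) j ^ 2 := Finset.sum_nonneg fun _ _ => sq_nonneg _
    have cT := mul_le_mul_of_nonneg_right bT sT
    have cS := mul_le_mul_of_nonneg_right bS sS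
    have dT := mul_le_mul_of_nonneg_left aT (sq_nonneg lamT)
    have dS := mul_le_mul_of_nonneg_left aS (sq_nonneg lamS)
    simp only [fromBlocks_mulVec, Fintype.sum_sum_type, Sum.elim_inl, Sum.elim_inr,
      zero_mulVec, add_zero, zero_add, smul_mulVec, Pi.smul_apply, smul_eq_mul, mul_pow,
      ← Finset.mul_sum]
    simp only [Function.comp_apply] at *
    linarith
  have hB : ‖fromBlocks 0 ((-beta) • GTS) ((-beta) • GTSᵀ) 0‖ ≤ |beta| := by
    refine kb_norm_le _ _ (abs_nonneg _) fun v => ?_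
    have aT := kb_partial GTS hGTS01 hGTSrow hGTScol (v ∘ Sum.inr)
    have aS := kb_partial GTSᵀ (fun i j => hGTS01 j i) hGTScol hGTSrow (v ∘ Sum.inl)
    have dT := mul_le_mul_of_nonneg_left aT (sq_nonneg beta)
    have dS := mul_le_mul_of_nonneg_left aS (sq_nonneg beta)
    simp only [fromBlocks_mulVec, Fintype.sum_sum_type, Sum.elim_inl, Sum.elim_inr,
      zero_mulVec, add_zero, zero_add, smul_mulVec, Pi.smul_apply, smul_eq_mul, mul_pow,
      ← Finset.mul_sum, sq_abs, neg_sq]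
    simp only [Function.comp_apply] at *
    linarith
  have hA1 : ‖A‖ < 1 := by
    have e : A = fromBlocks (lamT • GT) 0 0 (lamS • GS) +
        fromBlocks 0 ((-beta) • GTS) ((-beta) • GTSᵀ) 0 := by
      rw [hA, fromBlocks_add]; simp
    have := norm_add_le (fromBlocks (lamT • GT) 0 0 (lamS • GS))
      (fromBlocks 0 ((-beta) • GTS) ((-beta) • GTSᵀ) 0)
    rw [← e] at this
    linarith
  have hsum : HasSum (fun k : ℕ => A ^ k) (1 - A)⁻¹ := by
    have h := hasSum_geom_series_inverse A hA1
    rwa [← Matrix.nonsing_inv_eq_ringInverse] at h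
  have hu : IsUnit (1 - A) := isUnit_one_sub_of_norm_lt_one hA1
  have hdet : IsUnit (1 - A).det := (Matrix.isUnit_iff_isUnit_det _).1 hu
  refine ⟨?_, fun y => ⟨fun h => ?_, fun h => ?_⟩⟩
  · exact hsum.map (⟨⟨fun M => M *ᵥ Sum.elim alphaT alphaS, zero_mulVec _⟩,
      fun M N => add_mulVec M N _⟩ : Matrix (Fin nT ⊕ Fin nS) (Fin nT ⊕ Fin nS) ℝ →+
        (Fin nT ⊕ Fin nS → ℝ)) (Continuous.matrix_mulVec continuous_id continuous_const)
  · rw [← h, mulVec_mulVec, nonsing_inv_mul _ hdet, one_mulVec]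
  · rw [h, mulVec_mulVec, mul_nonsing_inv _ hdet, one_mulVec]
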